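/- Let N, m ≥ 1 be integers, let Ψ satisfy condition (K), and let p, q > 0 with either p + q ≥ 2 or p ≥ 1. If u ∈ C^{2m}(ℝ^N) is a non-negative solution of (−Δ)^m u ≥ (Ψ(|·|) * u^p) u^q in ℝ^N, then u is poly-superharmonic: for every 1 ≤ j ≤ m one has (−Δ)^j u ≥ 0 pointwise in ℝ^N. -/

import Mathlib

open MeasureTheory Filter Metric

/-- The Laplacian of `u : ℝ^N → ℝ`, defined via the second iterated Fréchet derivative. -/
noncomputable def lap {N : ℕ} (u : EuclideanSpace ℝ (Fin N) → ℝ) :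
    EuclideanSpace ℝ (Fin N) → ℝ :=
  fun x => ∑ i : Fin N,
    iteratedFDeriv ℝ 2 u x ![EuclideanSpace.single i 1, EuclideanSpace.single i 1]

/-- `negLapPow m u = (-Δ)^m u`, the `m`-fold iterate of the negative Laplacian. -/
noncomputable def negLapPow {N : ℕ} (m : ℕ) (u : EuclideanSpace ℝ (Fin N) → ℝ) :
    EuclideanSpace ℝ (Fin N) → ℝ :=
  (fun v => fun x => -(lap v x))^[m] u

/-- Condition (K) on the kernel `Ψ`. -/
structure CondK (N : ℕ) (Ψ : ℝ → ℝ) : Prop where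
  pos : ∀ r : ℝ, 0 < r → 0 < Ψ r
  cont : ContinuousOn (fun x : EuclideanSpace ℝ (Fin N) => Ψ ‖x‖)
    {(0 : EuclideanSpace ℝ (Fin N))}ᶜ
  locInt : LocallyIntegrable (fun x : EuclideanSpace ℝ (Fin N) => Ψ ‖x‖) volume
  anti : AntitoneOn Ψ (Set.Ioi (0 : ℝ))
  tendsto : Tendsto (fun r : ℝ => r ^ N * Ψ r) atTop atTop

/-- The compactly supported radial weight `(1 - |x|²)₊ ^ k`. -/
noncomputable def radialWeight {N : ℕ} (k : ℕ) (x : EuclideanSpace ℝ (Fin N)) : ℝ :=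
  max (1 - ‖x‖ ^ 2) 0 ^ k

/-- The weighted integral of `v` over the ball of radius `R` around `a`, rescaled to the
unit ball. -/
noncomputable def radialMean {N : ℕ} (v : EuclideanSpace ℝ (Fin N) → ℝ)
    (a : EuclideanSpace ℝ (Fin N)) (k : ℕ) (R : ℝ) : ℝ :=
  ∫ x, v (a + R • x) * radialWeight k x

section Weight

variable {N : ℕ}

lemma continuous_radialWeight (k : ℕ) :
    Continuous (radialWeight k : EuclideanSpace ℝ (Fin N) → ℝ) := by
  unfold radialWeight
  fun_prop

lemma radialWeight_nonneg (k : ℕ) (x : EuclideanSpace ℝ (Fin N)) : 0 ≤ radialWeight k x :=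
  pow_nonneg (le_max_right _ _) _

lemma radialWeight_le_one (k : ℕ) (x : EuclideanSpace ℝ (Fin N)) : radialWeight k x ≤ 1 :=
  pow_le_one₀ (le_max_right _ _) (max_le (by nlinarith [sq_nonneg ‖x‖]) zero_le_one)

lemma radialWeight_eq_zero {k : ℕ} (hk : k ≠ 0) {x : EuclideanSpace ℝ (Fin N)}
    (hx : 1 ≤ ‖x‖) : radialWeight k x = 0 := by
  unfold radialWeight
  rw [max_eq_right (by nlinarith), zero_pow hk]

lemma radialWeight_zero (k : ℕ) : radialWeight k (0 : EuclideanSpace ℝ (Fin N)) = 1 := by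
  simp [radialWeight]

lemma hasCompactSupport_radialWeight {k : ℕ} (hk : k ≠ 0) :
    HasCompactSupport (radialWeight k : EuclideanSpace ℝ (Fin N) → ℝ) := by
  refine HasCompactSupport.intro (isCompact_closedBall 0 1) fun x hx => ?_
  exact radialWeight_eq_zero hk (by simpa using (not_le.mp (by simpa using hx)).le)

lemma integrable_mul_radialWeight {k : ℕ} (hk : k ≠ 0) {f : EuclideanSpace ℝ (Fin N) → ℝ}
    (hf : Continuous f) : Integrable fun x => f x * radialWeight k x :=
  (hf.mul (continuous_radialWeight k)).integrable_of_hasCompactSupport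
    (hasCompactSupport_radialWeight hk).mul_left

lemma integral_radialWeight_pos {k : ℕ} (hk : k ≠ 0) :
    0 < ∫ x : EuclideanSpace ℝ (Fin N), radialWeight k x :=
  (continuous_radialWeight k).integral_pos_of_hasCompactSupport_nonneg_nonzero
    (hasCompactSupport_radialWeight hk) (radialWeight_nonneg k)
    (x := 0) (by simp [radialWeight_zero])

lemma hasDerivAt_max_zero_pow (k : ℕ) (s : ℝ) :
    HasDerivAt (fun s : ℝ => max s 0 ^ (k + 2)) ((k + 2) * max s 0 ^ (k + 1)) s := by
  rcases lt_trichotomy s 0 with h | rfl | h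
  · rw [max_eq_right h.le, zero_pow (by omega), mul_zero]
    refine (hasDerivAt_const s (0 : ℝ)).congr_of_eventuallyEq ?_
    filter_upwards [Iio_mem_nhds h] with t ht
    rw [max_eq_right (le_of_lt ht), zero_pow (by omega)]
  · rw [max_self, zero_pow (by omega), mul_zero, hasDerivAt_iff_tendsto_slope]
    have h : Tendsto (fun t : ℝ => max t 0 ^ (k + 1)) (nhdsWithin 0 {0}ᶜ) (nhds 0) := by
      have : Continuous fun t : ℝ => max t 0 ^ (k + 1) := by fun_prop
      simpa using (this.tendsto 0).mono_left nhdsWithin_le_nhds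
    refine h.congr' ?_
    filter_upwards [self_mem_nhdsWithin] with t ht
    have ht : t ≠ 0 := ht
    rcases le_total t 0 with h | h
    · simp [slope, h]
    · simp only [slope, max_eq_left h, sub_zero, max_self, vsub_eq_sub, smul_eq_mul]
      rw [zero_pow (by omega), sub_zero, pow_succ t (k + 1)]
      field_simp
  · rw [max_eq_left h.le]
    have h2 := hasDerivAt_pow (k + 2) s
    push_cast at h2
    refine h2.congr_of_eventuallyEq ?_
    filter_upwards [Ioi_mem_nhds h] with t ht
    rw [max_eq_left (le_of_lt ht)]

lemma hasFDerivAt_radialWeight (k : ℕ) (x : EuclideanSpace ℝ (Fin N)) :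
    HasFDerivAt (radialWeight (k + 2))
      ((-(2 * (k + 2) * radialWeight (k + 1) x)) • innerSL ℝ x) x := by
  have h1 : HasFDerivAt (fun x : EuclideanSpace ℝ (Fin N) => 1 - ‖x‖ ^ 2)
      (-(2 • innerSL ℝ x)) x := by
    simpa using ((hasStrictFDerivAt_norm_sq x).hasFDerivAt).const_sub 1
  have h2 := (hasDerivAt_max_zero_pow k (1 - ‖x‖ ^ 2)).comp_hasFDerivAt x h1
  refine h2.congr_fderiv ?_
  ext y
  simp [radialWeight]
  ring

end Weight

section Derivative

variable {N : ℕ}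

lemma lap_eq_sum_fderiv {v : EuclideanSpace ℝ (Fin N) → ℝ} (x : EuclideanSpace ℝ (Fin N)) :
    lap v x = ∑ i : Fin N, fderiv ℝ (fderiv ℝ v) x (EuclideanSpace.single i 1)
      (EuclideanSpace.single i 1) := by
  simp [lap, iteratedFDeriv_two_apply]

lemma contDiff_lap {v : EuclideanSpace ℝ (Fin N) → ℝ} {n : ℕ} (hv : ContDiff ℝ (n + 2 : ℕ) v) :
    ContDiff ℝ n (lap v) := by
  have h1 : ContDiff ℝ (n + 1 : ℕ) (fderiv ℝ v) := hv.fderiv_right (by norm_cast)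
  have h2 : ContDiff ℝ n (fderiv ℝ (fderiv ℝ v)) := h1.fderiv_right (by norm_cast)
  have : lap v = fun x => ∑ i : Fin N, fderiv ℝ (fderiv ℝ v) x (EuclideanSpace.single i 1)
      (EuclideanSpace.single i 1) := funext fun x => lap_eq_sum_fderiv x
  rw [this]
  fun_prop

lemma integral_fderiv_mul_radialWeight {v : EuclideanSpace ℝ (Fin N) → ℝ}
    (hv : ContDiff ℝ 2 v) (a : EuclideanSpace ℝ (Fin N)) (k : ℕ) (R : ℝ) :
    ∫ x, fderiv ℝ v (a + R • x) x * radialWeight (k + 1) x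
      = R / (2 * (k + 2)) * radialMean (lap v) a (k + 2) R := by
  have hk : (0 : ℝ) < 2 * (k + 2) := by positivity
  have h1 : ContDiff ℝ 1 (fderiv ℝ v) := hv.fderiv_right (by norm_num)
  have h2 : Continuous (fderiv ℝ (fderiv ℝ v)) := h1.continuous_fderiv (by norm_num)
  have h1c := h1.continuous
  have hmap : ∀ x, HasFDerivAt (fun x : EuclideanSpace ℝ (Fin N) => a + R • x)
      (R • ContinuousLinearMap.id ℝ (EuclideanSpace ℝ (Fin N))) x := fun x =>
    ((hasFDerivAt_id x).const_smul R).const_add a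
  have hparts : ∀ i : Fin N,
      ∫ x, fderiv ℝ v (a + R • x) (EuclideanSpace.single i 1) * (x i * radialWeight (k + 1) x)
      = R / (2 * (k + 2)) * ∫ x, fderiv ℝ (fderiv ℝ v) (a + R • x) (EuclideanSpace.single i 1)
          (EuclideanSpace.single i 1) * radialWeight (k + 2) x := by
    intro i
    set e : EuclideanSpace ℝ (Fin N) := EuclideanSpace.single i 1 with he
    have hf : ∀ x, HasFDerivAt (fun x => fderiv ℝ v (a + R • x) e)
        (((ContinuousLinearMap.apply ℝ ℝ e).comp (fderiv ℝ (fderiv ℝ v) (a + R • x))).comp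
          (R • ContinuousLinearMap.id ℝ _)) x := fun x =>
      ((ContinuousLinearMap.apply ℝ ℝ e).hasFDerivAt.comp _
        ((h1.differentiable (by norm_num)) _).hasFDerivAt).comp x (hmap x)
    have hw : ∀ x, fderiv ℝ (radialWeight (k + 2)) x e
        = -(2 * (k + 2)) * (x i * radialWeight (k + 1) x) := by
      intro x
      rw [(hasFDerivAt_radialWeight k x).fderiv]
      simp [he, EuclideanSpace.inner_single_right]
      ring
    have hfe : ∀ x, fderiv ℝ (fun x => fderiv ℝ v (a + R • x) e) x e
        = R * fderiv ℝ (fderiv ℝ v) (a + R • x) e e := by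
      intro x
      rw [(hf x).fderiv]
      simp
    have key := integral_mul_fderiv_eq_neg_fderiv_mul_of_integrable (μ := volume) (𝕜 := ℝ)
      (f := fun x => fderiv ℝ v (a + R • x) e) (g := radialWeight (k + 2)) (v := e)
      (by
        simp only [hfe]
        exact integrable_mul_radialWeight (by omega) (by fun_prop))
      (by
        simp only [hw]
        have := integrable_mul_radialWeight (N := N) (k := k + 1) (by omega)
          (f := fun x => fderiv ℝ v (a + R • x) e * (-(2 * (k + 2)) * x i)) (by fun_prop)
        refine this.congr (Eventually.of_forall fun x => ?_)
        simp only
        ring)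
      (integrable_mul_radialWeight (by omega) (by fun_prop))
      (fun x _ => (hf x).differentiableAt)
      (fun x _ => (hasFDerivAt_radialWeight k x).differentiableAt)
    simp only [hw, hfe] at key
    have e1 : ∀ x : EuclideanSpace ℝ (Fin N), fderiv ℝ v (a + R • x) e *
        (-(2 * (k + 2)) * (x i * radialWeight (k + 1) x)) = -(2 * (k + 2)) *
        (fderiv ℝ v (a + R • x) e * (x i * radialWeight (k + 1) x)) := fun x => by ring
    have e2 : ∀ x : EuclideanSpace ℝ (Fin N), R * fderiv ℝ (fderiv ℝ v) (a + R • x) e e *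
        radialWeight (k + 2) x = R * (fderiv ℝ (fderiv ℝ v) (a + R • x) e e *
        radialWeight (k + 2) x) := fun x => by ring
    simp only [e1, e2, integral_const_mul] at key
    rw [div_mul_eq_mul_div, eq_div_iff hk.ne']
    linarith
  have hsum : ∀ x : EuclideanSpace ℝ (Fin N), fderiv ℝ v (a + R • x) x * radialWeight (k + 1) x
      = ∑ i : Fin N, fderiv ℝ v (a + R • x) (EuclideanSpace.single i 1) *
        (x i * radialWeight (k + 1) x) := by
    intro x
    have hx : x = ∑ i : Fin N, x i • EuclideanSpace.single i (1 : ℝ) := by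
      have := (EuclideanSpace.basisFun (Fin N) ℝ).sum_repr x
      simpa using this.symm
    conv_lhs => enter [1, 2]; rw [hx]
    rw [map_sum, Finset.sum_mul]
    refine Finset.sum_congr rfl fun i _ => ?_
    rw [map_smul, smul_eq_mul]
    ring
  simp only [hsum]
  rw [integral_finsetSum]
  · simp only [hparts, radialMean, lap_eq_sum_fderiv, Finset.sum_mul]
    rw [integral_finsetSum, Finset.mul_sum]
    intro i _
    exact integrable_mul_radialWeight (by omega) (by fun_prop)
  · intro i _
    simp only [← mul_assoc]
    exact integrable_mul_radialWeight (by omega) (by fun_prop)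

lemma hasDerivAt_radialMean {v : EuclideanSpace ℝ (Fin N) → ℝ}
    (hv : ContDiff ℝ 2 v) (a : EuclideanSpace ℝ (Fin N)) (k : ℕ) (R : ℝ) :
    HasDerivAt (radialMean v a (k + 1)) (R / (2 * (k + 2)) * radialMean (lap v) a (k + 2) R) R := by
  rw [← integral_fderiv_mul_radialWeight hv]
  have hvc := hv.continuous
  have hv' : Continuous (fderiv ℝ v) := hv.continuous_fderiv (by norm_num)
  have hc : Continuous fun z : ℝ × EuclideanSpace ℝ (Fin N) =>
      fderiv ℝ v (a + z.1 • z.2) z.2 := by fun_prop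
  obtain ⟨C, hC⟩ := ((isCompact_closedBall R 1).prod
    (isCompact_closedBall (0 : EuclideanSpace ℝ (Fin N)) 1)).exists_bound_of_continuousOn
      hc.continuousOn
  refine (hasDerivAt_integral_of_dominated_loc_of_deriv_le (μ := volume)
    (F := fun r x => v (a + r • x) * radialWeight (k + 1) x)
    (F' := fun r x => fderiv ℝ v (a + r • x) x * radialWeight (k + 1) x)
    (bound := fun x => C * radialWeight (k + 1) x)
    (Metric.ball_mem_nhds R one_pos) ?_ ?_ ?_ ?_ ?_ ?_).2
  · refine Eventually.of_forall fun r => ?_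
    exact (integrable_mul_radialWeight (by omega) (by fun_prop)).aestronglyMeasurable
  · exact integrable_mul_radialWeight (by omega) (by fun_prop)
  · exact (integrable_mul_radialWeight (by omega) (by fun_prop)).aestronglyMeasurable
  · refine Eventually.of_forall fun x r hr => ?_
    rw [norm_mul, Real.norm_of_nonneg (radialWeight_nonneg _ _)]
    rcases le_total 1 ‖x‖ with h | h
    · simp [radialWeight_eq_zero _ h]
    · exact mul_le_mul_of_nonneg_right
        (hC (r, x) ⟨ball_subset_closedBall hr, by simpa using h⟩) (radialWeight_nonneg _ _)
  · exact integrable_mul_radialWeight (by omega) continuous_const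
  · refine Eventually.of_forall fun x r _ => ?_
    have h1 : HasDerivAt (fun r : ℝ => a + r • x) x r := by
      simpa using ((hasDerivAt_id r).smul_const x).const_add a
    exact (((hv.differentiable (by norm_num)) _).hasFDerivAt.comp_hasDerivAt r h1).mul_const _

end Derivative

section RadialChain

lemma le_sub_of_hasDerivAt_mul {g f : ℝ → ℝ} {c a b L : ℝ} (hc : 0 ≤ c)
    (hg : ∀ R, HasDerivAt g (c * R * f R) R) (ha : 0 ≤ a) (hab : a ≤ b) (hL : 0 ≤ L)
    (hf : ∀ r ∈ Set.Icc a b, L ≤ f r) : c * a * L * (b - a) ≤ g b - g a := by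
  refine (convex_Icc a b).mul_sub_le_image_sub_of_le_deriv
    (fun x _ => (hg x).continuousAt.continuousWithinAt)
    (fun x _ => (hg x).differentiableAt.differentiableWithinAt) ?_ a (Set.left_mem_Icc.2 hab) b
    (Set.right_mem_Icc.2 hab) hab
  intro x hx
  rw [(hg x).deriv]
  have hx := interior_subset hx
  have := hf x hx
  have hax := hx.1
  have hx0 : 0 ≤ x := ha.trans hax
  gcongr

lemma tendsto_atTop_of_hasDerivAt_mul {g f : ℝ → ℝ} {c δ : ℝ} (hc : 0 < c) (hδ : 0 < δ)
    (hg : ∀ R, HasDerivAt g (c * R * f R) R) (hf : ∀ᶠ R in atTop, δ ≤ f R) :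
    Tendsto g atTop atTop := by
  obtain ⟨a, ha⟩ := eventually_atTop.1 (hf.and (eventually_ge_atTop 1))
  have ha1 : 1 ≤ a := (ha a le_rfl).2
  have h : Tendsto (fun R => g a + c * a * δ * (R - a)) atTop atTop := by
    refine tendsto_atTop_add_const_left _ _ (Tendsto.const_mul_atTop (by positivity) ?_)
    exact tendsto_atTop_add_const_right _ (-a) tendsto_id
  refine tendsto_atTop_mono' _ ?_ h
  filter_upwards [eventually_ge_atTop a] with R hR
  have := le_sub_of_hasDerivAt_mul hc.le hg (by linarith) hR hδ.le fun r hr => (ha r hr.1).1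
  linarith

variable {m : ℕ} {G : ℕ → ℝ → ℝ} {c : ℕ → ℝ}

lemma tendsto_atTop_of_chain (hc : ∀ j < m, 0 < c j)
    (hG : ∀ j < m, ∀ R, HasDerivAt (G j) (c j * R * G (j + 1) R) R) {i : ℕ} (hi : i ≤ m)
    {ε δ : ℝ} (hδ : 0 < δ) (h : ∀ᶠ R in atTop, δ ≤ ε * G i R) {j : ℕ} (hj : j < i) :
    Tendsto (fun R => ε * G j R) atTop atTop := by
  have hd : ∀ j < m, ∀ R, HasDerivAt (fun R => ε * G j R) (c j * R * (ε * G (j + 1) R)) R := by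
    intro j hj R
    exact ((hG j hj R).const_mul ε).congr_deriv (by ring)
  have key : ∀ l j, j + l + 1 = i → Tendsto (fun R => ε * G j R) atTop atTop := by
    intro l
    induction l with
    | zero =>
      rintro j rfl
      exact tendsto_atTop_of_hasDerivAt_mul (hc j (by omega)) hδ (hd j (by omega)) h
    | succ l ih =>
      intro j hj
      exact tendsto_atTop_of_hasDerivAt_mul (hc j (by omega)) one_pos (hd j (by omega))
        ((ih (j + 1) (by omega)).eventually_ge_atTop 1)
  exact key (i - j - 1) j (by omega)

lemma pow_mul_le_of_chain {κ R₀ : ℝ} (hκ : 0 ≤ κ) (hc : ∀ j < m, κ ≤ c j)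
    (hG : ∀ j < m, ∀ R, HasDerivAt (G j) (c j * R * G (j + 1) R) R) (hR₀ : 0 ≤ R₀)
    (hnn : ∀ j < m, ∀ r, R₀ ≤ r → 0 ≤ G j r) {a b h L : ℝ} (ha : R₀ ≤ a) (hh : 0 ≤ h)
    (hL : 0 ≤ L) (hm : ∀ r ∈ Set.Icc a b, L ≤ G m r) {l : ℕ} (hl : l ≤ m) :
    ∀ r ∈ Set.Icc (a + l * h) b, (κ * a * h) ^ l * L ≤ G (m - l) r := by
  have ha0 : 0 ≤ a := hR₀.trans ha
  induction l with
  | zero => simpa using hm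
  | succ l ih =>
    intro r hr
    have hlh : 0 ≤ l * h := by positivity
    obtain ⟨hr1, hr2⟩ := hr
    push_cast at hr1
    have hj : m - (l + 1) < m := by omega
    have hder := hG _ hj
    rw [show m - (l + 1) + 1 = m - l by omega] at hder
    have hLl : 0 ≤ (κ * a * h) ^ l * L := by positivity
    have := le_sub_of_hasDerivAt_mul (hκ.trans (hc _ hj)) hder (a := r - h) (b := r)
      (by linarith) (by linarith) hLl fun s hs =>
        ih (by omega) s ⟨by linarith [hs.1], by linarith [hs.2]⟩
    have h0 := hnn _ hj (r - h) (by linarith)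
    have hκa : κ * a ≤ c (m - (l + 1)) * (r - h) :=
      mul_le_mul (hc _ hj) (by linarith) ha0 (hκ.trans (hc _ hj))
    calc (κ * a * h) ^ (l + 1) * L = κ * a * ((κ * a * h) ^ l * L) * h := by ring
      _ ≤ c (m - (l + 1)) * (r - h) * ((κ * a * h) ^ l * L) * (r - (r - h)) := by
          rw [sub_sub_cancel]
          gcongr
      _ ≤ G (m - (l + 1)) r := by linarith

lemma not_superquadratic {f : ℝ → ℝ} (hf : Continuous f) (hlim : Tendsto f atTop atTop)
    {K C R₀ : ℝ} {n : ℕ} (hK : 0 < K)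
    (h : ∀ r, R₀ ≤ r → ∀ θ, 0 < θ → θ ≤ 1 → C ≤ f r * θ ^ n →
      K * θ ^ n * f r ^ 2 ≤ f (r * (1 + θ))) : False := by
  set A : ℝ := 4 ^ n * max C (2 ^ (n + 1) / K) with hA
  have hApos : 0 < A := by
    have : 0 < max C (2 ^ (n + 1) / K) := lt_max_of_lt_right (by positivity)
    positivity
  obtain ⟨r, hr⟩ := eventually_atTop.1
    ((hlim.eventually_ge_atTop A).and (eventually_ge_atTop (max R₀ 1)))
  obtain ⟨hrA, hr1⟩ := hr r le_rfl
  have hrpos : 0 < r := by linarith [le_max_right R₀ 1]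
  have hx : ∀ k : ℕ, 0 < ((2 : ℝ) ^ k)⁻¹ ∧ ((2 : ℝ) ^ k)⁻¹ ≤ 1 := fun k =>
    ⟨by positivity, inv_le_one_of_one_le₀ (one_le_pow₀ (by norm_num))⟩
  have grow : ∀ k : ℕ, A * 2 ^ ((n + 1) * k) ≤ f (r * (2 - (2 ^ k)⁻¹)) := by
    intro k
    induction k with
    | zero =>
      norm_num
      exact hrA
    | succ k ih =>
      obtain ⟨hx0, hx1⟩ := hx k
      set x : ℝ := (2 ^ k)⁻¹ with hxdef
      set θ : ℝ := x / 2 / (2 - x) with hθ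
      have h2x : 0 < 2 - x := by linarith
      have hθ0 : 0 < θ := by positivity
      have hθ1 : θ ≤ 1 := by rw [hθ, div_le_one h2x]; linarith
      have hθx : x / 4 ≤ θ := by
        rw [hθ, le_div_iff₀ h2x]
        nlinarith
      have hxk : x ^ n * 2 ^ ((n + 1) * k) = 2 ^ k := by
        rw [hxdef, inv_pow, ← pow_mul, add_mul, one_mul, pow_add, mul_comm k n]
        field_simp
      have hlow : A * (4 ^ n)⁻¹ * 2 ^ k ≤ f (r * (2 - x)) * θ ^ n := by
        calc A * (4 ^ n)⁻¹ * 2 ^ k = (A * 2 ^ ((n + 1) * k)) * (x / 4) ^ n := by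
              rw [← hxk, div_pow]; field_simp
          _ ≤ f (r * (2 - x)) * θ ^ n := by
              gcongr
              exact le_trans (by positivity) ih
      have hA4 : A * (4 ^ n)⁻¹ = max C (2 ^ (n + 1) / K) := by
        rw [hA]; field_simp
      have h2k : (1 : ℝ) ≤ 2 ^ k := one_le_pow₀ (by norm_num)
      have hmaxpos : 0 < max C (2 ^ (n + 1) / K) := lt_max_of_lt_right (by positivity)
      rw [hA4] at hlow
      have hC : C ≤ f (r * (2 - x)) * θ ^ n :=
        (le_max_left _ _).trans ((le_mul_of_one_le_right hmaxpos.le h2k).trans hlow)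
      have hR : R₀ ≤ r * (2 - x) := by
        have : R₀ ≤ r := (le_max_left _ _).trans hr1
        nlinarith
      have hstep := h _ hR θ hθ0 hθ1 hC
      have hpt : r * (2 - x) * (1 + θ) = r * (2 - (2 ^ (k + 1))⁻¹) := by
        have : ((2 : ℝ) ^ (k + 1))⁻¹ = x / 2 := by rw [hxdef, pow_succ]; field_simp
        rw [this, hθ]
        field_simp
        ring
      rw [hpt] at hstep
      refine le_trans ?_ hstep
      have hKlow : 2 ^ (n + 1) ≤ K * max C (2 ^ (n + 1) / K) := by
        have := mul_le_mul_of_nonneg_left (le_max_right C (2 ^ (n + 1) / K)) hK.le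
        rwa [mul_div_cancel₀ _ hK.ne'] at this
      have hlow' : max C (2 ^ (n + 1) / K) ≤ f (r * (2 - x)) * θ ^ n :=
        (le_mul_of_one_le_right hmaxpos.le h2k).trans hlow
      calc A * 2 ^ ((n + 1) * (k + 1)) = 2 ^ (n + 1) * (A * 2 ^ ((n + 1) * k)) := by ring
        _ ≤ (K * (f (r * (2 - x)) * θ ^ n)) * f (r * (2 - x)) := by
            have hfθ : 0 ≤ f (r * (2 - x)) * θ ^ n := hmaxpos.le.trans hlow'
            refine mul_le_mul ?_ ih (by positivity) (by positivity)
            exact hKlow.trans (mul_le_mul_of_nonneg_left hlow' hK.le)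
        _ = K * θ ^ n * f (r * (2 - x)) ^ 2 := by ring
  obtain ⟨B, hB⟩ := (isCompact_Icc (a := r) (b := 2 * r)).exists_bound_of_continuousOn
    hf.continuousOn
  obtain ⟨k, hk⟩ := pow_unbounded_of_one_lt (B / A) (one_lt_two : (1 : ℝ) < 2)
  have h1 := grow k
  have h2 := hB (r * (2 - (2 ^ k)⁻¹)) ⟨by nlinarith [(hx k).2], by nlinarith [(hx k).1]⟩
  have h3 : (2 : ℝ) ^ k ≤ 2 ^ ((n + 1) * k) :=
    pow_le_pow_right₀ (by norm_num) (by nlinarith)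
  rw [div_lt_iff₀ hApos] at hk
  have h4 := le_of_abs_le h2
  nlinarith

end RadialChain

section Mean

variable {N : ℕ}

lemma radialMean_nonneg {v : EuclideanSpace ℝ (Fin N) → ℝ} (hv : ∀ x, 0 ≤ v x)
    (a : EuclideanSpace ℝ (Fin N)) (k : ℕ) (R : ℝ) : 0 ≤ radialMean v a k R :=
  integral_nonneg fun _ => mul_nonneg (hv _) (radialWeight_nonneg _ _)

lemma radialMean_neg (v : EuclideanSpace ℝ (Fin N) → ℝ) (a : EuclideanSpace ℝ (Fin N)) (k : ℕ)
    (R : ℝ) : radialMean (fun x => -v x) a k R = -radialMean v a k R := by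
  simp only [radialMean, neg_mul, integral_neg]

lemma radialMean_radius_zero (v : EuclideanSpace ℝ (Fin N) → ℝ) (a : EuclideanSpace ℝ (Fin N))
    (k : ℕ) : radialMean v a k 0 = v a * ∫ x : EuclideanSpace ℝ (Fin N), radialWeight k x := by
  simp only [radialMean, zero_smul, add_zero, integral_const_mul]

lemma integral_mul_radialWeight_comp (f : EuclideanSpace ℝ (Fin N) → ℝ)
    (a : EuclideanSpace ℝ (Fin N)) (k : ℕ) {R : ℝ} (hR : 0 < R) :
    ∫ y, f y * radialWeight k (R⁻¹ • (y - a)) = R ^ N * radialMean f a k R := by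
  have h := Measure.integral_comp_smul (volume : Measure (EuclideanSpace ℝ (Fin N)))
    (fun z => f (a + z) * radialWeight k (R⁻¹ • z)) R
  rw [← integral_add_left_eq_self _ a]
  simp only [add_sub_cancel_left]
  simp only [smul_smul, inv_mul_cancel₀ hR.ne', one_smul, finrank_euclideanSpace,
    Fintype.card_fin, smul_eq_mul] at h
  rw [radialMean, h, abs_of_pos (by positivity), mul_inv_cancel_left₀ (by positivity)]

lemma radialWeight_comp_eq_zero {k : ℕ} (hk : k ≠ 0) {a y : EuclideanSpace ℝ (Fin N)} {R : ℝ}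
    (hR : 0 < R) (h : R ≤ ‖y - a‖) : radialWeight k (R⁻¹ • (y - a)) = 0 := by
  refine radialWeight_eq_zero hk ?_
  rw [norm_smul, norm_inv, Real.norm_of_nonneg hR.le, inv_mul_eq_div, le_div_iff₀ hR]
  simpa using h

lemma integrable_mul_radialWeight_comp {f : EuclideanSpace ℝ (Fin N) → ℝ} (hf : Continuous f)
    (a : EuclideanSpace ℝ (Fin N)) {k : ℕ} (hk : k ≠ 0) {R : ℝ} (hR : 0 < R) :
    Integrable fun y => f y * radialWeight k (R⁻¹ • (y - a)) := by
  have := continuous_radialWeight (N := N) k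
  refine Continuous.integrable_of_hasCompactSupport (by fun_prop) ?_
  refine HasCompactSupport.intro (isCompact_closedBall a R) fun x hx => ?_
  rw [radialWeight_comp_eq_zero hk hR, mul_zero]
  rw [mem_closedBall, dist_eq_norm] at hx
  exact (not_le.mp hx).le

lemma pow_mul_radialWeight_le {k j : ℕ} {r h R : ℝ} (hr : 0 < r) (hh : 0 ≤ h) (hrR : r + h ≤ R)
    (hR : R ≤ 2 * r) (z : EuclideanSpace ℝ (Fin N)) :
    (h / (2 * r)) ^ j * radialWeight (k + 1) (r⁻¹ • z) ≤ radialWeight (k + 1 + j) (R⁻¹ • z) := by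
  have hR0 : 0 < R := by linarith
  rcases le_total r ‖z‖ with hz | hz
  · rw [radialWeight_eq_zero (by omega), mul_zero]
    · exact radialWeight_nonneg _ _
    · rw [norm_smul, norm_inv, Real.norm_of_nonneg hr.le, inv_mul_eq_div, le_div_iff₀ hr]
      simpa using hz
  · have hn : ∀ s : ℝ, 0 < s → ‖s⁻¹ • z‖ = ‖z‖ / s := fun s hs => by
      rw [norm_smul, norm_inv, Real.norm_of_nonneg hs.le, inv_mul_eq_div]
    unfold radialWeight
    rw [pow_add _ (k + 1) j, mul_comm, hn _ hr, hn _ hR0]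
    have hzr : ‖z‖ / r ≤ 1 := (div_le_one hr).2 hz
    have hzR : ‖z‖ / R ≤ ‖z‖ / r := by gcongr; linarith
    have hz0 : 0 ≤ ‖z‖ / R := by positivity
    have hzR' : ‖z‖ / R ≤ r / R := by gcongr
    have hrR1 : r / R ≤ 1 := (div_le_one hR0).2 (by linarith)
    have hlow : h / (2 * r) ≤ 1 - r / R := by
      have : 1 - r / R = (R - r) / R := by field_simp
      rw [this]
      exact div_le_div₀ (by linarith) (by linarith) hR0 hR
    refine mul_le_mul ?_ ?_ (by positivity) (by positivity)
    · gcongr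
    · refine pow_le_pow_left₀ (by positivity) (le_max_of_le_left (hlow.trans ?_)) _
      nlinarith

lemma mul_radialMean_le {v : EuclideanSpace ℝ (Fin N) → ℝ} (hv : Continuous v)
    (hv0 : ∀ x, 0 ≤ v x) (a : EuclideanSpace ℝ (Fin N)) {k j : ℕ} {r h R : ℝ} (hr : 0 < r)
    (hh : 0 ≤ h) (hrR : r + h ≤ R) (hR : R ≤ 2 * r) :
    (2 ^ N)⁻¹ * (h / (2 * r)) ^ j * radialMean v a (k + 1) r
      ≤ radialMean v a (k + 1 + j) R := by
  have hR0 : 0 < R := by linarith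
  have key : (h / (2 * r)) ^ j * (r ^ N * radialMean v a (k + 1) r)
      ≤ R ^ N * radialMean v a (k + 1 + j) R := by
    rw [← integral_mul_radialWeight_comp _ _ _ hr, ← integral_mul_radialWeight_comp _ _ _ hR0,
      ← integral_const_mul]
    refine integral_mono ((integrable_mul_radialWeight_comp hv a (by omega) hr).const_mul _)
      (integrable_mul_radialWeight_comp hv a (by omega) hR0) fun y => ?_
    have := mul_le_mul_of_nonneg_left (pow_mul_radialWeight_le (k := k) (j := j) hr hh hrR hR
      (y - a)) (hv0 y)
    simp only
    linarith
  have hRN : R ^ N ≤ 2 ^ N * r ^ N := by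
    rw [← mul_pow]
    exact pow_le_pow_left₀ hR0.le hR N
  have hP := radialMean_nonneg hv0 a (k + 1 + j) R
  have h2 : r ^ N * ((h / (2 * r)) ^ j * radialMean v a (k + 1) r)
      ≤ r ^ N * (2 ^ N * radialMean v a (k + 1 + j) R) := by
    calc _ = (h / (2 * r)) ^ j * (r ^ N * radialMean v a (k + 1) r) := by ring
      _ ≤ R ^ N * radialMean v a (k + 1 + j) R := key
      _ ≤ 2 ^ N * r ^ N * radialMean v a (k + 1 + j) R := by gcongr
      _ = _ := by ring
  have h3 := le_of_mul_le_mul_left h2 (by positivity)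
  rw [mul_assoc, inv_mul_le_iff₀ (by positivity)]
  exact h3

lemma half_radialMean_le_rpow {u : EuclideanSpace ℝ (Fin N) → ℝ} (hu : Continuous u)
    (hu0 : ∀ x, 0 ≤ u x) {p : ℝ} (hp : 1 ≤ p)
    (a : EuclideanSpace ℝ (Fin N)) {k : ℕ} (hk : k ≠ 0) {R : ℝ}
    (hR : 2 * ∫ x : EuclideanSpace ℝ (Fin N), radialWeight k x ≤ radialMean u a k R) :
    radialMean u a k R / 2
      ≤ radialMean (fun x => u x ^ p) a k R := by
  have hcont : Continuous fun x => u x ^ p := hu.rpow_const fun _ => Or.inr (by linarith)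
  have h1i : Integrable (radialWeight k : EuclideanSpace ℝ (Fin N) → ℝ) := by
    simpa using integrable_mul_radialWeight hk (continuous_const (y := (1 : ℝ)))
  have hpi : Integrable fun x => u (a + R • x) ^ p * radialWeight k x :=
    integrable_mul_radialWeight hk (hcont.comp (by fun_prop))
  have h1 : radialMean u a k R ≤ (∫ x : EuclideanSpace ℝ (Fin N), radialWeight k x)
      + radialMean (fun x => u x ^ p) a k R := by
    rw [radialMean, radialMean, ← integral_add h1i hpi]
    refine integral_mono (integrable_mul_radialWeight hk (by fun_prop)) (h1i.add hpi) fun x => ?_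
    have hle : u (a + R • x) ≤ 1 + u (a + R • x) ^ p := by
      rcases le_total (u (a + R • x)) 1 with h | h
      · have := Real.rpow_nonneg (hu0 (a + R • x)) p
        linarith
      · have := Real.rpow_le_rpow_of_exponent_le h hp
        rw [Real.rpow_one] at this
        linarith
    have := mul_le_mul_of_nonneg_right hle (radialWeight_nonneg k x)
    simp only
    linarith
  linarith

lemma radialMean_sq_le {u : EuclideanSpace ℝ (Fin N) → ℝ} (hu : Continuous u)
    (hu0 : ∀ x, 0 ≤ u x) {p q : ℝ} (hp : 0 < p) (hq : 0 < q) (hpq : 2 ≤ p + q)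
    (a : EuclideanSpace ℝ (Fin N)) {k : ℕ} (hk : k ≠ 0) {R : ℝ}
    (hR : 2 * ∫ x : EuclideanSpace ℝ (Fin N), radialWeight k x ≤ radialMean u a k R) :
    (radialMean u a k R / 2) ^ 2
      ≤ radialMean (fun x => u x ^ p) a k R * radialMean (fun x => u x ^ q) a k R := by
  have hcont : ∀ s : ℝ, 0 ≤ s → Continuous fun x => u x ^ s := fun s hs =>
    hu.rpow_const fun _ => Or.inr hs
  have hint : ∀ s : ℝ, 0 ≤ s → Integrable fun x => u (a + R • x) ^ s * radialWeight k x :=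
    fun s hs => integrable_mul_radialWeight hk ((hcont s hs).comp (by fun_prop))
  set Z := radialMean (fun x => u x ^ ((p + q) / 2)) a k R with hZ
  have hZlow : radialMean u a k R / 2 ≤ Z :=
    half_radialMean_le_rpow hu hu0 (by linarith) a hk hR
  have hV := (integral_radialWeight_pos (N := N) hk).le
  have hquad : ∀ t : ℝ, 0 ≤ radialMean (fun x => u x ^ p) a k R * (t * t) + (-2 * Z) * t
      + radialMean (fun x => u x ^ q) a k R := by
    intro t
    have : radialMean (fun x => u x ^ p) a k R * (t * t) + (-2 * Z) * t
        + radialMean (fun x => u x ^ q) a k R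
        = ∫ x, (t * u (a + R • x) ^ (p / 2) - u (a + R • x) ^ (q / 2)) ^ 2
            * radialWeight k x := by
      have e : ∀ x : EuclideanSpace ℝ (Fin N),
          (t * u (a + R • x) ^ (p / 2) - u (a + R • x) ^ (q / 2)) ^ 2 * radialWeight k x
          = (u (a + R • x) ^ p * radialWeight k x) * (t * t)
            + (u (a + R • x) ^ ((p + q) / 2) * radialWeight k x) * (-2 * t)
            + u (a + R • x) ^ q * radialWeight k x := by
        intro x
        have hx := hu0 (a + R • x)
        have e1 : u (a + R • x) ^ p = u (a + R • x) ^ (p / 2) * u (a + R • x) ^ (p / 2) := by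
          rw [← Real.rpow_add_of_nonneg hx (by positivity) (by positivity), add_halves]
        have e2 : u (a + R • x) ^ q = u (a + R • x) ^ (q / 2) * u (a + R • x) ^ (q / 2) := by
          rw [← Real.rpow_add_of_nonneg hx (by positivity) (by positivity), add_halves]
        have e3 : u (a + R • x) ^ ((p + q) / 2)
            = u (a + R • x) ^ (p / 2) * u (a + R • x) ^ (q / 2) := by
          rw [← Real.rpow_add_of_nonneg hx (by positivity) (by positivity), add_div]
        rw [e1, e2, e3]
        ring
      simp only [e]
      rw [integral_add, integral_add, integral_mul_const, integral_mul_const]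
      · simp only [hZ, radialMean]
        ring
      · exact (hint _ hp.le).mul_const _
      · exact (hint _ (by positivity)).mul_const _
      · exact ((hint _ hp.le).mul_const _).add ((hint _ (by positivity)).mul_const _)
      · exact hint _ hq.le
    rw [this]
    exact integral_nonneg fun x => mul_nonneg (sq_nonneg _) (radialWeight_nonneg _ _)
  have hdisc := discrim_le_zero hquad
  rw [discrim] at hdisc
  have : (radialMean u a k R / 2) ^ 2 ≤ Z ^ 2 := pow_le_pow_left₀ (by linarith) hZlow 2
  linarith

end Mean

section Kernel

variable {N : ℕ} {Ψ : ℝ → ℝ} {u : EuclideanSpace ℝ (Fin N) → ℝ} {p : ℝ}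

lemma ae_ne_of_one_le (hN : 1 ≤ N) (x : EuclideanSpace ℝ (Fin N)) :
    ∀ᵐ y : EuclideanSpace ℝ (Fin N), y ≠ x := by
  have : Nonempty (Fin N) := ⟨⟨0, hN⟩⟩
  exact compl_mem_ae_iff.2 (measure_singleton x)

lemma integral_kernel_nonneg (hN : 1 ≤ N) (hK : CondK N Ψ) (hu0 : ∀ x, 0 ≤ u x)
    (x : EuclideanSpace ℝ (Fin N)) : 0 ≤ ∫ y, u y ^ p * Ψ ‖y - x‖ := by
  refine integral_nonneg_of_ae ?_
  filter_upwards [ae_ne_of_one_le hN x] with y hy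
  exact mul_nonneg (Real.rpow_nonneg (hu0 y) p) (hK.pos _ (norm_pos_iff.2 (sub_ne_zero.2 hy))).le

lemma integrable_kernel (hK : CondK N Ψ) (hu : Continuous u) (hu0 : ∀ x, 0 ≤ u x) (hp : 0 < p)
    (hint : IntegrableOn (fun y : EuclideanSpace ℝ (Fin N) => u y ^ p * Ψ (‖y‖ / 2))
      {y : EuclideanSpace ℝ (Fin N) | 1 < ‖y‖}) (x : EuclideanSpace ℝ (Fin N)) :
    Integrable fun y => u y ^ p * Ψ ‖y - x‖ := by
  have hup : Continuous fun y => u y ^ p := hu.rpow_const fun _ => Or.inr hp.le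
  have hmp := measurePreserving_sub_right (volume : Measure (EuclideanSpace ℝ (Fin N))) x
  have hmeas : AEStronglyMeasurable (fun y : EuclideanSpace ℝ (Fin N) => Ψ ‖y - x‖) volume :=
    hK.locInt.aestronglyMeasurable.comp_measurePreserving hmp
  set ρ : ℝ := max 1 (2 * ‖x‖)
  have hnear : IntegrableOn (fun y => u y ^ p * Ψ ‖y - x‖) (closedBall 0 ρ) := by
    have h1 := hK.locInt.integrableOn_isCompact
      (isCompact_closedBall (0 : EuclideanSpace ℝ (Fin N)) (ρ + ‖x‖))
    rw [← hmp.integrableOn_comp_preimage (MeasurableEquiv.subRight x).measurableEmbedding] at h1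
    refine IntegrableOn.continuousOn_mul hup.continuousOn (h1.mono_set fun y hy => ?_)
      (isCompact_closedBall _ _)
    simp only [Set.mem_preimage, mem_closedBall, dist_zero_right] at hy ⊢
    exact (norm_sub_le y x).trans (by linarith)
  have hfar : IntegrableOn (fun y => u y ^ p * Ψ ‖y - x‖) (closedBall 0 ρ)ᶜ := by
    have hsub : (closedBall (0 : EuclideanSpace ℝ (Fin N)) ρ)ᶜ ⊆ {y | 1 < ‖y‖} := by
      intro y hy
      simp only [Set.mem_compl_iff, mem_closedBall, dist_zero_right, not_le] at hy
      exact lt_of_le_of_lt (le_max_left _ _) hy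
    refine Integrable.mono' (hint.mono_set hsub)
      (hup.aestronglyMeasurable.mul hmeas).restrict ?_
    refine (ae_restrict_iff' measurableSet_closedBall.compl).2 (Eventually.of_forall fun y hy => ?_)
    simp only [Set.mem_compl_iff, mem_closedBall, dist_zero_right, not_le] at hy
    have hy1 : 1 < ‖y‖ := lt_of_le_of_lt (le_max_left _ _) hy
    have hyx : 2 * ‖x‖ < ‖y‖ := lt_of_le_of_lt (le_max_right _ _) hy
    have hle : ‖y‖ / 2 ≤ ‖y - x‖ := by linarith [norm_sub_norm_le y x]
    have h0 : 0 < ‖y‖ / 2 := by linarith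
    have hup0 := Real.rpow_nonneg (hu0 y) p
    rw [Real.norm_of_nonneg (mul_nonneg hup0 (hK.pos _ (h0.trans_le hle)).le)]
    exact mul_le_mul_of_nonneg_left (hK.anti h0 (h0.trans_le hle) hle) hup0
  rw [← integrableOn_univ, ← Set.union_compl_self (closedBall (0 : EuclideanSpace ℝ (Fin N)) ρ)]
  exact hnear.union hfar

lemma mul_radialMean_le_integral_kernel (hN : 1 ≤ N) (hK : CondK N Ψ) (hu : Continuous u)
    (hu0 : ∀ x, 0 ≤ u x) (hp : 0 < p)
    (hint : IntegrableOn (fun y : EuclideanSpace ℝ (Fin N) => u y ^ p * Ψ (‖y‖ / 2))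
      {y : EuclideanSpace ℝ (Fin N) | 1 < ‖y‖}) {a x : EuclideanSpace ℝ (Fin N)} {k : ℕ}
    (hk : k ≠ 0) {R : ℝ} (hR : 0 < R) (hx : ‖x - a‖ ≤ R) :
    Ψ (2 * R) * R ^ N * radialMean (fun x => u x ^ p) a k R ≤ ∫ y, u y ^ p * Ψ ‖y - x‖ := by
  have hup : Continuous fun y => u y ^ p := hu.rpow_const fun _ => Or.inr hp.le
  rw [mul_assoc, ← integral_mul_radialWeight_comp _ _ _ hR, ← integral_const_mul]
  refine integral_mono_ae ((integrable_mul_radialWeight_comp hup a hk hR).const_mul _)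
    (integrable_kernel hK hu hu0 hp hint x) ?_
  filter_upwards [ae_ne_of_one_le hN x] with y hy
  have hyx : 0 < ‖y - x‖ := norm_pos_iff.2 (sub_ne_zero.2 hy)
  have hup0 := Real.rpow_nonneg (hu0 y) p
  rcases le_total R ‖y - a‖ with h | h
  · rw [radialWeight_comp_eq_zero hk hR h, mul_zero, mul_zero]
    exact mul_nonneg hup0 (hK.pos _ hyx).le
  · have hle : ‖y - x‖ ≤ 2 * R := by
      have := norm_sub_le_norm_sub_add_norm_sub y a x
      rw [norm_sub_rev a x] at this
      linarith
    have hΨ : Ψ (2 * R) ≤ Ψ ‖y - x‖ := hK.anti hyx (show 0 < 2 * R by linarith) hle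
    have hΨ0 := (hK.pos (2 * R) (by linarith)).le
    calc Ψ (2 * R) * (u y ^ p * radialWeight k (R⁻¹ • (y - a)))
        ≤ Ψ (2 * R) * (u y ^ p * 1) := by
          gcongr
          exact radialWeight_le_one _ _
      _ ≤ u y ^ p * Ψ ‖y - x‖ := by
          rw [mul_one, mul_comm]
          gcongr

lemma mul_radialMean_rpow_le (hK : CondK N Ψ) (hu : Continuous u)
    (hu0 : ∀ x, 0 ≤ u x) (hp : 0 < p)
    (hint : IntegrableOn (fun y : EuclideanSpace ℝ (Fin N) => u y ^ p * Ψ (‖y‖ / 2))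
      {y : EuclideanSpace ℝ (Fin N) | 1 < ‖y‖}) (a : EuclideanSpace ℝ (Fin N)) {k : ℕ}
    (hk : k ≠ 0) {R : ℝ} (hR : 0 < R) (haR : ‖a‖ ≤ R) :
    Ψ R * (R ^ N * radialMean (fun x => u x ^ p) a k R)
      ≤ Ψ R * (∫ y in closedBall (0 : EuclideanSpace ℝ (Fin N)) 1, u y ^ p)
        + ∫ y in {y : EuclideanSpace ℝ (Fin N) | 1 < ‖y‖}, u y ^ p * Ψ (‖y‖ / 2) := by
  have hup : Continuous fun y => u y ^ p := hu.rpow_const fun _ => Or.inr hp.le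
  have hΨ0 := (hK.pos R hR).le
  have hcompl : (closedBall (0 : EuclideanSpace ℝ (Fin N)) 1)ᶜ = {y | 1 < ‖y‖} := by
    ext y
    simp
  have hwi := integrable_mul_radialWeight_comp hup a hk hR
  rw [← integral_mul_radialWeight_comp _ _ _ hR,
    ← integral_add_compl (measurableSet_closedBall (x := (0 : EuclideanSpace ℝ (Fin N)))
      (ε := 1)) hwi, hcompl, mul_add]
  have hmeas : MeasurableSet {y : EuclideanSpace ℝ (Fin N) | 1 < ‖y‖} :=
    hcompl ▸ measurableSet_closedBall.compl
  refine add_le_add (mul_le_mul_of_nonneg_left ?_ hΨ0) ?_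
  · refine setIntegral_mono hwi.integrableOn
      (hup.continuousOn.integrableOn_compact (isCompact_closedBall _ _)) fun y => ?_
    exact mul_le_of_le_one_right (Real.rpow_nonneg (hu0 y) p) (radialWeight_le_one _ _)
  · rw [← integral_const_mul]
    refine setIntegral_mono_on (hwi.integrableOn.const_mul _) hint hmeas fun y hy => ?_
    have hy1 : 1 < ‖y‖ := hy
    have hy0 : 0 < ‖y‖ / 2 := by linarith
    have hup0 := Real.rpow_nonneg (hu0 y) p
    rcases le_total R ‖y - a‖ with h | h
    · rw [radialWeight_comp_eq_zero hk hR h, mul_zero, mul_zero]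
      exact mul_nonneg hup0 (hK.pos _ hy0).le
    · have hle : ‖y‖ / 2 ≤ R := by linarith [norm_sub_norm_le y a]
      have hΨ : Ψ R ≤ Ψ (‖y‖ / 2) := hK.anti hy0 hR hle
      calc Ψ R * (u y ^ p * radialWeight k (R⁻¹ • (y - a)))
          ≤ Ψ R * (u y ^ p * 1) := by
            gcongr
            exact radialWeight_le_one _ _
        _ ≤ u y ^ p * Ψ (‖y‖ / 2) := by
            rw [mul_one, mul_comm]
            gcongr

lemma not_tendsto_radialMean_of_one_le (hN : 1 ≤ N) (hK : CondK N Ψ) (hu : Continuous u)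
    (hu0 : ∀ x, 0 ≤ u x) (hp : 1 ≤ p)
    (hint : IntegrableOn (fun y : EuclideanSpace ℝ (Fin N) => u y ^ p * Ψ (‖y‖ / 2))
      {y : EuclideanSpace ℝ (Fin N) | 1 < ‖y‖}) (a : EuclideanSpace ℝ (Fin N)) {k : ℕ}
    (hk : k ≠ 0) (hlim : Tendsto (radialMean u a k) atTop atTop) : False := by
  set V := ∫ x : EuclideanSpace ℝ (Fin N), radialWeight k x
  have hV : 0 < V := integral_radialWeight_pos hk
  set C := ∫ y in closedBall (0 : EuclideanSpace ℝ (Fin N)) 1, u y ^ p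
  set I := ∫ y in {y : EuclideanSpace ℝ (Fin N) | 1 < ‖y‖}, u y ^ p * Ψ (‖y‖ / 2)
  have hpow : Tendsto (fun R : ℝ => R ^ N) atTop atTop := tendsto_pow_atTop (by omega)
  obtain ⟨R, h1, h2, h3, h4, h5⟩ := ((hlim.eventually_ge_atTop (2 * V)).and
    ((eventually_gt_atTop 0).and ((eventually_ge_atTop ‖a‖).and
    ((hpow.eventually_ge_atTop (2 * C / V)).and
    (hK.tendsto.eventually_gt_atTop (2 * I / V)))))).exists
  have hb := mul_radialMean_rpow_le hK hu hu0 (by linarith) hint a hk h2 h3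
  have hlow := half_radialMean_le_rpow hu hu0 hp a hk h1
  have hΨ := hK.pos R h2
  rw [div_le_iff₀ hV] at h4
  rw [div_lt_iff₀ hV] at h5
  have e1 : Ψ R * (R ^ N * V) ≤ Ψ R * (R ^ N * radialMean (fun x => u x ^ p) a k R) := by
    gcongr
    linarith
  have e2 : Ψ R * (2 * C) ≤ Ψ R * (R ^ N * V) := by gcongr
  change _ ≤ Ψ R * C + I at hb
  linarith

end Kernel

section Iterates

variable {N m : ℕ} {u : EuclideanSpace ℝ (Fin N) → ℝ}

lemma negLapPow_succ (j : ℕ) (u : EuclideanSpace ℝ (Fin N) → ℝ) :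
    negLapPow (j + 1) u = fun x => -lap (negLapPow j u) x :=
  Function.iterate_succ_apply' _ _ _

lemma contDiff_negLapPow (hu : ContDiff ℝ (2 * m : ℕ) u) {j : ℕ} (hj : j ≤ m) :
    ContDiff ℝ (2 * (m - j) : ℕ) (negLapPow j u) := by
  induction j with
  | zero => exact hu
  | succ j ih =>
    rw [negLapPow_succ]
    have h := ih (by omega)
    rw [show 2 * (m - j) = 2 * (m - (j + 1)) + 2 by omega] at h
    exact (contDiff_lap h).neg

lemma hasDerivAt_radialMean_negLapPow (hu : ContDiff ℝ (2 * m : ℕ) u) {j : ℕ} (hj : j < m)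
    (a : EuclideanSpace ℝ (Fin N)) (R : ℝ) :
    HasDerivAt (radialMean (negLapPow j u) a (j + 1))
      (-(1 / (2 * (j + 2)) * R * radialMean (negLapPow (j + 1) u) a (j + 2) R)) R := by
  have h2 : ContDiff ℝ 2 (negLapPow j u) :=
    (contDiff_negLapPow hu hj.le).of_le (by norm_cast; omega)
  refine (hasDerivAt_radialMean h2 a j R).congr_deriv ?_
  rw [negLapPow_succ, radialMean_neg]
  ring

lemma hasDerivAt_signed_radialMean (hu : ContDiff ℝ (2 * m : ℕ) u) {j : ℕ} (hj : j < m)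
    (a : EuclideanSpace ℝ (Fin N)) (R : ℝ) :
    HasDerivAt (fun R => (-1) ^ j * radialMean (negLapPow j u) a (j + 1) R)
      (1 / (2 * ((j : ℝ) + 2)) * R *
        ((-1) ^ (j + 1) * radialMean (negLapPow (j + 1) u) a (j + 1 + 1) R)) R :=
  ((hasDerivAt_radialMean_negLapPow hu hj a R).const_mul _).congr_deriv (by ring)

/-- If the mean of `(-Δ)^m u` dominates the square of the mean of `u` on all large balls, then the
means of `u` cannot tend to infinity: they would blow up at a finite radius. -/
lemma not_tendsto_radialMean_of_sq_le (hm : 1 ≤ m) (hu : ContDiff ℝ (2 * m : ℕ) u)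
    (hu0 : ∀ x, 0 ≤ u x) (a : EuclideanSpace ℝ (Fin N)) {D : ℝ}
    (hsq : ∀ᶠ R in atTop, D ≤ radialMean u a (m + 1) R →
      (radialMean u a (m + 1) R / 2) ^ 2 ≤ radialMean (negLapPow m u) a (m + 1) R)
    (hlim : Tendsto (radialMean u a 1) atTop atTop) : False := by
  have hucont : Continuous u := hu.continuous
  set G : ℕ → ℝ → ℝ := fun j R => (-1) ^ j * radialMean (negLapPow j u) a (j + 1) R with hG
  set c : ℕ → ℝ := fun j => 1 / (2 * ((j : ℝ) + 2)) with hc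
  have hder : ∀ j < m, ∀ R, HasDerivAt (G j) (c j * R * G (j + 1) R) R := fun j hj R =>
    hasDerivAt_signed_radialMean hu hj a R
  have hcpos : ∀ j < m, 0 < c j := fun j _ => by
    simp only [hc]
    positivity
  have hG0 : G 0 = radialMean u a 1 := by
    funext R
    simp [hG, negLapPow]
  have hcomp : ∀ r h R : ℝ, 0 < r → 0 ≤ h → r + h ≤ R → R ≤ 2 * r →
      (2 ^ N)⁻¹ * (h / (2 * r)) ^ m * radialMean u a 1 r ≤ radialMean u a (m + 1) R := by
    intro r h R h1 h2 h3 h4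
    have := mul_radialMean_le hucont hu0 a (k := 0) (j := m) h1 h2 h3 h4
    rwa [zero_add, add_comm 1 m] at this
  have hP : Tendsto (radialMean u a (m + 1)) atTop atTop := by
    have h1 : Tendsto (fun R : ℝ => (2 ^ N)⁻¹ * (1 / 2) ^ m * radialMean u a 1 (R / 2))
        atTop atTop :=
      Tendsto.const_mul_atTop (by positivity)
        (hlim.comp (tendsto_id.atTop_div_const (by norm_num)))
    refine tendsto_atTop_mono' _ ?_ h1
    filter_upwards [eventually_gt_atTop 0] with R hR
    have := hcomp (R / 2) (R / 2) R (by linarith) (by linarith) (by linarith) (by linarith)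
    rwa [show R / 2 / (2 * (R / 2)) = 1 / 2 by field_simp] at this
  have hpm : (-1 : ℝ) ^ m * (-1) ^ m = 1 := by rw [← mul_pow]; norm_num
  have htop : ∀ᶠ R in atTop, 1 ≤ (-1) ^ m * G m R := by
    filter_upwards [hsq, hP.eventually_ge_atTop D, hP.eventually_ge_atTop 2] with R h1 h2 h3
    have := h1 h2
    simp only [hG]
    rw [← mul_assoc, hpm, one_mul]
    nlinarith
  have hchain : ∀ j < m, Tendsto (fun R => (-1) ^ m * G j R) atTop atTop := fun j hj =>
    tendsto_atTop_of_chain hcpos hder le_rfl one_pos htop hj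
  have heven : (-1 : ℝ) ^ m = 1 := by
    rcases neg_one_pow_eq_or ℝ m with h | h
    · exact h
    · exfalso
      obtain ⟨R, h1, h2⟩ := (((hchain 0 hm).eventually_ge_atTop 1).and
        (hlim.eventually_ge_atTop 0)).exists
      rw [h, hG0] at h1
      linarith
  simp only [heven, one_mul] at hchain
  have hall : ∀ᶠ R in atTop, ∀ j ∈ Finset.range m, 0 ≤ G j R :=
    (Filter.eventually_all_finset _).2 fun j hj =>
      (hchain j (Finset.mem_range.1 hj)).eventually_ge_atTop 0
  obtain ⟨R₀, hR₀⟩ := eventually_atTop.1 (hall.and (hsq.and (eventually_ge_atTop 1)))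
  have hR₀1 : 1 ≤ R₀ := (hR₀ R₀ le_rfl).2.2
  set κ : ℝ := 1 / (2 * ((m : ℝ) + 2)) with hκ
  have hκ0 : 0 < κ := by positivity
  have hκc : ∀ j < m, κ ≤ c j := fun j hj => by
    have : (j : ℝ) ≤ m := by exact_mod_cast hj.le
    simp only [hκ, hc]
    gcongr
  set B : ℝ := (2 ^ N)⁻¹ * (1 / (2 * ((m : ℝ) + 1))) ^ m with hB
  have hB0 : 0 < B := by positivity
  have hcont : Continuous (radialMean u a 1) := by
    rw [← hG0]
    exact continuous_iff_continuousAt.2 fun R => (hder 0 hm R).continuousAt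
  refine not_superquadratic hcont hlim (K := (κ / (m + 1)) ^ m * (B / 2) ^ 2) (C := D / B)
    (R₀ := R₀) (n := 3 * m) (by positivity) ?_
  intro r hr θ hθ0 hθ1 hC
  have hr1 : 1 ≤ r := hR₀1.trans hr
  have hr0 : 0 < r := by linarith
  set f := radialMean u a 1 r with hf
  have hf0 : 0 ≤ f := radialMean_nonneg hu0 a 1 r
  set h : ℝ := θ * r / (m + 1) with hh
  have hh0 : 0 < h := by positivity
  have hmh : (m + 1) * h = θ * r := by rw [hh]; field_simp
  have hθr : θ * r ≤ r := by nlinarith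
  have hratio : h / (2 * r) = θ * (1 / (2 * ((m : ℝ) + 1))) := by rw [hh]; field_simp
  have hPlow : ∀ R ∈ Set.Icc (r + h) (r * (1 + θ)), B * (f * θ ^ m)
      ≤ radialMean u a (m + 1) R := by
    intro R hR
    have := hcomp r h R hr0 hh0.le hR.1 (by nlinarith [hR.2])
    rw [hratio, mul_pow] at this
    rw [hB]
    linarith
  have hθm : θ ^ (3 * m) ≤ θ ^ m := pow_le_pow_of_le_one hθ0.le hθ1 (by omega)
  have hD : D ≤ B * (f * θ ^ m) := by
    rw [div_le_iff₀ hB0] at hC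
    have : f * θ ^ (3 * m) * B ≤ f * θ ^ m * B := by gcongr
    linarith
  have hL : ∀ R ∈ Set.Icc (r + h) (r * (1 + θ)), (B * (f * θ ^ m) / 2) ^ 2 ≤ G m R := by
    intro R hR
    have h1 := hPlow R hR
    have h2 := (hR₀ R (by linarith [hR.1])).2.1 (hD.trans h1)
    have h3 : (B * (f * θ ^ m) / 2) ^ 2 ≤ (radialMean u a (m + 1) R / 2) ^ 2 := by
      gcongr
    simp only [hG, heven, one_mul]
    exact h3.trans h2
  have hfin := pow_mul_le_of_chain hκ0.le hκc hder (by linarith : 0 ≤ R₀)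
    (fun j hj s hs => (hR₀ s hs).1 j (Finset.mem_range.2 hj)) (by linarith : R₀ ≤ r + h) hh0.le
    (sq_nonneg _) hL le_rfl (r * (1 + θ)) ⟨by linarith, le_rfl⟩
  rw [Nat.sub_self, hG0] at hfin
  refine le_trans ?_ hfin
  have hbase : κ / (m + 1) * θ ≤ κ * (r + h) * h := by
    have e1 : κ / (m + 1) * θ = κ * 1 * (θ * 1 / (m + 1)) := by ring
    rw [e1, hh]
    gcongr
    linarith
  calc (κ / (m + 1)) ^ m * (B / 2) ^ 2 * θ ^ (3 * m) * f ^ 2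
      = (κ / (m + 1) * θ) ^ m * (B * (f * θ ^ m) / 2) ^ 2 := by ring
    _ ≤ (κ * (r + h) * h) ^ m * (B * (f * θ ^ m) / 2) ^ 2 := by gcongr

lemma tendsto_radialMean_of_negLapPow_neg (hu : ContDiff ℝ (2 * m : ℕ) u)
    (hu0 : ∀ x, 0 ≤ u x) {i : ℕ} (hi : i < m) (hsucc : ∀ x, 0 ≤ negLapPow (i + 1) u x)
    {a : EuclideanSpace ℝ (Fin N)} (ha : negLapPow i u a < 0) :
    Tendsto (radialMean u a 1) atTop atTop := by
  have hi0 : i ≠ 0 := by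
    rintro rfl
    exact absurd (hu0 a) (not_le.2 ha)
  set G : ℕ → ℝ → ℝ := fun j R => (-1) ^ j * radialMean (negLapPow j u) a (j + 1) R with hG
  have hG0 : G 0 = radialMean u a 1 := by
    funext R
    simp [hG, negLapPow]
  set V := ∫ x : EuclideanSpace ℝ (Fin N), radialWeight (i + 1) x
  have hV : 0 < V := integral_radialWeight_pos (by omega)
  set δ : ℝ := -(negLapPow i u a * V) with hδ
  have hδ0 : 0 < δ := by
    have := mul_neg_of_neg_of_pos ha hV
    linarith
  have hdecr : ∀ R, 0 ≤ R → δ ≤ -radialMean (negLapPow i u) a (i + 1) R := by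
    intro R hR
    have hd : ∀ R, HasDerivAt (fun R => -radialMean (negLapPow i u) a (i + 1) R)
        (1 / (2 * ((i : ℝ) + 2)) * R * radialMean (negLapPow (i + 1) u) a (i + 2) R) R := fun R =>
      ((hasDerivAt_radialMean_negLapPow hu hi a R).neg).congr_deriv (by ring)
    have := le_sub_of_hasDerivAt_mul (by positivity) hd le_rfl hR le_rfl
      fun r _ => radialMean_nonneg hsucc a (i + 2) r
    rw [radialMean_radius_zero] at this
    change _ ≤ _ - -(negLapPow i u a * V) at this
    linarith
  have hsign : (-1 : ℝ) ^ (i + 1) * (-1) ^ i = -1 := by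
    rw [pow_succ, mul_right_comm, ← mul_pow]
    norm_num
  have hev : ∀ᶠ R in atTop, δ ≤ (-1) ^ (i + 1) * G i R := by
    filter_upwards [eventually_ge_atTop 0] with R hR
    simp only [hG]
    rw [← mul_assoc, hsign, neg_one_mul]
    exact hdecr R hR
  have hlim := tendsto_atTop_of_chain (m := m) (G := G)
    (c := fun j => 1 / (2 * ((j : ℝ) + 2))) (fun j _ => by positivity)
    (fun j hj R => hasDerivAt_signed_radialMean hu hj a R) hi.le hδ0 hev (Nat.pos_of_ne_zero hi0)
  rw [hG0] at hlim
  rcases neg_one_pow_eq_or ℝ (i + 1) with h | h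
  · simpa [h] using hlim
  · exfalso
    obtain ⟨R, hR⟩ := (hlim.eventually_ge_atTop 1).exists
    rw [h] at hR
    linarith [radialMean_nonneg hu0 a 1 R]

lemma eventually_sq_le_radialMean {Ψ : ℝ → ℝ} {p q : ℝ} (hN : 1 ≤ N) (hK : CondK N Ψ)
    (hp : 0 < p) (hq : 0 < q) (hpq : 2 ≤ p + q) (hu : ContDiff ℝ (2 * m : ℕ) u)
    (hu0 : ∀ x, 0 ≤ u x)
    (hint : IntegrableOn (fun y : EuclideanSpace ℝ (Fin N) => u y ^ p * Ψ (‖y‖ / 2))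
      {y : EuclideanSpace ℝ (Fin N) | 1 < ‖y‖})
    (hineq : ∀ x : EuclideanSpace ℝ (Fin N),
      (∫ y : EuclideanSpace ℝ (Fin N), u y ^ p * Ψ ‖y - x‖) * u x ^ q ≤ negLapPow m u x)
    (a : EuclideanSpace ℝ (Fin N)) {k : ℕ} (hk : k ≠ 0) :
    ∀ᶠ R in atTop, 2 * ∫ x : EuclideanSpace ℝ (Fin N), radialWeight k x ≤ radialMean u a k R →
      (radialMean u a k R / 2) ^ 2 ≤ radialMean (negLapPow m u) a k R := by
  have hucont : Continuous u := hu.continuous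
  have hlapcont : Continuous (negLapPow m u) := (contDiff_negLapPow hu le_rfl).continuous
  have huq : Continuous fun y => u y ^ q := hucont.rpow_const fun _ => Or.inr hq.le
  have hgrow := (hK.tendsto.comp (tendsto_id.const_mul_atTop (two_pos : (0 : ℝ) < 2))
    ).eventually_ge_atTop (2 ^ N)
  filter_upwards [hgrow, eventually_gt_atTop 0] with R hR hR0 hlow
  have hΨ : 1 ≤ Ψ (2 * R) * R ^ N := by
    simp only [Function.comp_apply, id_eq, mul_pow] at hR
    have : (0 : ℝ) < 2 ^ N := by positivity
    nlinarith
  refine (radialMean_sq_le hucont hu0 hp hq hpq a hk hlow).trans ?_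
  set X := radialMean (fun x => u x ^ p) a k R
  have hX0 : 0 ≤ X := radialMean_nonneg (fun x => Real.rpow_nonneg (hu0 x) p) a k R
  rw [radialMean, radialMean, ← integral_const_mul]
  refine integral_mono ((integrable_mul_radialWeight hk (f := fun x => u (a + R • x) ^ q)
    (huq.comp (by fun_prop))).const_mul _) (integrable_mul_radialWeight hk (by fun_prop))
    fun x => ?_
  rcases le_total 1 ‖x‖ with h | h
  · simp [radialWeight_eq_zero hk h]
  · have hx : ‖a + R • x - a‖ ≤ R := by
      rw [add_sub_cancel_left, norm_smul, Real.norm_of_nonneg hR0.le]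
      exact mul_le_of_le_one_right hR0.le h
    have hker : X ≤ ∫ y, u y ^ p * Ψ ‖y - (a + R • x)‖ :=
      (le_mul_of_one_le_left hX0 hΨ).trans
        (mul_radialMean_le_integral_kernel hN hK hucont hu0 hp hint hk hR0 hx)
    have h1 := (mul_le_mul_of_nonneg_right hker (Real.rpow_nonneg (hu0 (a + R • x)) q)).trans
      (hineq (a + R • x))
    have h2 := mul_le_mul_of_nonneg_right h1 (radialWeight_nonneg k x)
    simp only
    linarith

end Iterates

theorem stmt_2 (N m : ℕ) (hN : 1 ≤ N) (hm : 1 ≤ m)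
    (Ψ : ℝ → ℝ) (hK : CondK N Ψ)
    (p q : ℝ) (hp : 0 < p) (hq : 0 < q) (hcond : 2 ≤ p + q ∨ 1 ≤ p)
    (u : EuclideanSpace ℝ (Fin N) → ℝ)
    (hreg : ContDiff ℝ (2 * m) u)
    (hpos : ∀ x, 0 ≤ u x)
    (hint : IntegrableOn (fun y : EuclideanSpace ℝ (Fin N) => u y ^ p * Ψ (‖y‖ / 2))
      {y : EuclideanSpace ℝ (Fin N) | 1 < ‖y‖})
    (hineq : ∀ x : EuclideanSpace ℝ (Fin N),
      (∫ y : EuclideanSpace ℝ (Fin N), u y ^ p * Ψ ‖y - x‖) * u x ^ q ≤ negLapPow m u x) :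
    ∀ j, 1 ≤ j → j ≤ m → ∀ x, 0 ≤ negLapPow j u x := by
  have hu : ContDiff ℝ (2 * m : ℕ) u := by exact_mod_cast hreg
  have hu_cont : Continuous u := hu.continuous
  have key : ∀ l j, j + l = m → ∀ x, 0 ≤ negLapPow j u x := by
    intro l
    induction l with
    | zero =>
      rintro j rfl x
      exact (mul_nonneg (integral_kernel_nonneg hN hK hpos x)
        (Real.rpow_nonneg (hpos x) q)).trans (hineq x)
    | succ l ih =>
      intro j hj a
      by_contra! ha
      have hlim := tendsto_radialMean_of_negLapPow_neg hu hpos (by omega)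
        (ih (j + 1) (by omega)) ha
      rcases hcond with hpq | hp1
      · exact not_tendsto_radialMean_of_sq_le hm hu hpos a
          (eventually_sq_le_radialMean hN hK hp hq hpq hu hpos hint hineq a m.succ_ne_zero) hlim
      · exact not_tendsto_radialMean_of_one_le hN hK hu_cont hpos hp1 hint a one_ne_zero hlim
  intro j _ hj x
  exact key (m - j) j (by omega) x
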